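/- arXiv:1703.09390 — 2 statements merged into one kernel-verified Lean document; each statement's English description precedes it below -/
import Mathlib

section
/- Let S and A be metric spaces, let L_f ≥ 0, L_R ≥ 0, L_π ≥ 0, and α ≥ 0 be real constants, let f : S × A → S satisfy dist(f(s,a), f(s',a')) ≤ L_f·(dist(s,s') + dist(a,a')) for all s,s' ∈ S and a,a' ∈ A, let r : S × A → ℝ satisfy |r(s,a) − r(s',a')| ≤ L_R·(dist(s,s') + dist(a,a')) for all s,s' ∈ S and a,a' ∈ A, and let π : S → A satisfy dist(π(s), π(s')) ≤ L_π·dist(s,s') for all s,s' ∈ S. Fix a horizon h ∈ ℕ. Let u, v, s̃ : ℕ → S and ã : ℕ → A be sequences with u(0) = v(0), u(t+1) = f(u(t), π(u(t))) for all t, and, for every t < h, dist(v(t), s̃(t)) + dist(π(v(t)), ã(t)) ≤ α and v(t+1) = f(s̃(t), ã(t)). Then |∑_{t=0}^{h-1} r(u(t), π(u(t))) − ∑_{t=0}^{h-1} r(s̃(t), ã(t))| ≤ C·α, where C = L_R·∑_{i=0}^{h-1} ∑_{j=0}^{h-i-1} (L_f·(1 + L_π))^j. -/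
/-- A pair within distance `α` of `(s', π s')` is within distance
`(1 + Lπ) * dist s s' + α` of `(s, π s)`. -/
lemma dist_add_dist_le_of_lipschitz_policy {S A : Type*} [PseudoMetricSpace S]
    [PseudoMetricSpace A] {Lπ α : ℝ} {π : S → A}
    (hπ : ∀ s s' : S, dist (π s) (π s') ≤ Lπ * dist s s') {s s' x : S} {a : A}
    (h : dist s' x + dist (π s') a ≤ α) :
    dist s x + dist (π s) a ≤ (1 + Lπ) * dist s s' + α := by
  linarith [dist_triangle s s' x, dist_triangle (π s) (π s') a, hπ s s']

/-- A discrete affine Grönwall inequality. -/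
lemma le_geom_sum_mul_of_le_mul_add {K α : ℝ} (hK : 0 ≤ K) {e : ℕ → ℝ} {h : ℕ}
    (h0 : e 0 ≤ α) (hstep : ∀ t < h, e (t + 1) ≤ K * e t + α) :
    ∀ t ≤ h, e t ≤ (∑ j ∈ Finset.range (t + 1), K ^ j) * α := by
  intro t
  induction t with
  | zero => simpa using h0
  | succ t ih =>
    intro ht
    rw [geom_sum_succ]
    linarith [hstep t ht, mul_le_mul_of_nonneg_left (ih (by omega)) hK]

/-- Deterministic trajectory-level core of the MFMC bias bound (Fonteneau et al.):
the cumulative reward of the MFMC surrogate trajectory deviates from the true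
on-policy cumulative reward by at most `C * α`, where
`C = LR * ∑_{i=0}^{h-1} ∑_{j=0}^{h-i-1} (Lf * (1 + Lπ)) ^ j`. -/
theorem mfmc_bias_core {S A : Type*} [MetricSpace S] [MetricSpace A]
    (Lf LR Lπ α : ℝ) (hLf : 0 ≤ Lf) (hLR : 0 ≤ LR) (hLπ : 0 ≤ Lπ) (hα : 0 ≤ α)
    (f : S × A → S) (r : S × A → ℝ) (π : S → A)
    (hf : ∀ (s s' : S) (a a' : A),
      dist (f (s, a)) (f (s', a')) ≤ Lf * (dist s s' + dist a a'))
    (hr : ∀ (s s' : S) (a a' : A),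
      |r (s, a) - r (s', a')| ≤ LR * (dist s s' + dist a a'))
    (hπ : ∀ s s' : S, dist (π s) (π s') ≤ Lπ * dist s s')
    (h : ℕ) (u v sTil : ℕ → S) (aTil : ℕ → A)
    (h0 : u 0 = v 0)
    (hu : ∀ t : ℕ, u (t + 1) = f (u t, π (u t)))
    (hmatch : ∀ t < h, dist (v t) (sTil t) + dist (π (v t)) (aTil t) ≤ α)
    (hv : ∀ t < h, v (t + 1) = f (sTil t, aTil t)) :
    |∑ t ∈ Finset.range h, r (u t, π (u t)) -
        ∑ t ∈ Finset.range h, r (sTil t, aTil t)| ≤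
      (LR * ∑ i ∈ Finset.range h, ∑ j ∈ Finset.range (h - i), (Lf * (1 + Lπ)) ^ j)
        * α := by
  have hgap : ∀ t < h, dist (u t) (sTil t) + dist (π (u t)) (aTil t) ≤
      (1 + Lπ) * dist (u t) (v t) + α := fun t ht ↦
    dist_add_dist_le_of_lipschitz_policy hπ (hmatch t ht)
  have hgrowth := le_geom_sum_mul_of_le_mul_add (K := Lf * (1 + Lπ)) (α := α) (h := h)
    (e := fun t ↦ (1 + Lπ) * dist (u t) (v t) + α) (by positivity) (by simp [h0])
    (fun t ht ↦ by
      have hdist : dist (u (t + 1)) (v (t + 1)) ≤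
          Lf * ((1 + Lπ) * dist (u t) (v t) + α) := by
        rw [hu, hv t ht]
        exact (hf _ _ _ _).trans (mul_le_mul_of_nonneg_left (hgap t ht) hLf)
      have hscaled := mul_le_mul_of_nonneg_left hdist (show 0 ≤ 1 + Lπ by positivity)
      linarith)
  have hreindex : ∑ i ∈ Finset.range h, ∑ j ∈ Finset.range (h - i), (Lf * (1 + Lπ)) ^ j =
      ∑ t ∈ Finset.range h, ∑ j ∈ Finset.range (t + 1), (Lf * (1 + Lπ)) ^ j := by
    rw [← Finset.sum_range_reflect]
    refine Finset.sum_congr rfl fun t ht ↦ ?_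
    have := Finset.mem_range.mp ht
    rw [show h - (h - 1 - t) = t + 1 by omega]
  rw [hreindex, mul_assoc, Finset.sum_mul, Finset.mul_sum, ← Finset.sum_sub_distrib]
  refine (Finset.abs_sum_le_sum_abs _ _).trans (Finset.sum_le_sum fun t ht ↦ ?_)
  have ht := Finset.mem_range.mp ht
  exact (hr _ _ _ _).trans
    (mul_le_mul_of_nonneg_left ((hgap t ht).trans (hgrowth t ht.le)) hLR)
end

section
/- Let X be a metric space, let q ≥ 0, L ≥ 0, and α ≥ 0 be real constants, and fix a horizon h ∈ ℕ. For each t ∈ ℕ let g_t : X → X satisfy dist(g_t(x), g_t(y)) ≤ q·dist(x,y) for all x,y ∈ X, and let r_t : X → ℝ satisfy |r_t(x) − r_t(y)| ≤ L·dist(x,y) for all x,y ∈ X. Let u, v, x̃ : ℕ → X be sequences with u(0) = v(0), u(t+1) = g_t(u(t)) for all t, and, for every t < h, dist(v(t), x̃(t)) ≤ α and v(t+1) = g_t(x̃(t)). Then |∑_{t=0}^{h-1} r_t(u(t)) − ∑_{t=0}^{h-1} r_t(x̃(t))| ≤ C_i·α, where C_i = L·∑_{b=0}^{h-1} ∑_{j=0}^{h-b-1}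 q^j. -/
/-- If a trajectory `x` restarts each step within `α` of the image of its previous state under a
`q`-Lipschitz map, its distance to the exact trajectory `u` grows at most like a geometric sum. -/
theorem dist_le_geom_sum_mul {X : Type*} [PseudoMetricSpace X]
    {q α : ℝ} (hq : 0 ≤ q) {h : ℕ} {g : ℕ → X → X}
    (hg : ∀ (t : ℕ) (x y : X), dist (g t x) (g t y) ≤ q * dist x y)
    {u v x : ℕ → X} (h0 : u 0 = v 0) (hu : ∀ t : ℕ, u (t + 1) = g t (u t))
    (hmatch : ∀ t < h, dist (v t) (x t) ≤ α) (hv : ∀ t < h, v (t + 1) = g t (x t))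
    {t : ℕ} (ht : t < h) :
    dist (u t) (x t) ≤ (∑ j ∈ Finset.range (t + 1), q ^ j) * α := by
  induction t with
  | zero => simpa [h0] using hmatch 0 ht
  | succ t ih =>
    have ht' : t < h := Nat.lt_of_succ_lt ht
    calc dist (u (t + 1)) (x (t + 1))
        ≤ dist (u (t + 1)) (v (t + 1)) + dist (v (t + 1)) (x (t + 1)) := dist_triangle _ _ _
      _ ≤ q * dist (u t) (x t) + α := by
          refine add_le_add ?_ (hmatch _ ht)
          rw [hu, hv t ht']
          exact hg t _ _
      _ ≤ q * ((∑ j ∈ Finset.range (t + 1), q ^ j) * α) + α := by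
          gcongr
          exact ih ht'
      _ = (∑ j ∈ Finset.range (t + 1 + 1), q ^ j) * α := by
          rw [geom_sum_succ (n := t + 1)]
          ring

/-- Deterministic trajectory-level core of the MFMCi bias bound (Corollary 1):
with time-dependent `q`-Lipschitz transition maps `g t` and `L`-Lipschitz reward
maps `r t` on the Markovian state alone, the cumulative reward of the MFMCi
surrogate trajectory deviates from the true cumulative reward by at most
`Ci * α`, where `Ci = L * ∑_{b=0}^{h-1} ∑_{j=0}^{h-b-1} q ^ j`. -/
theorem mfmci_bias_core {X : Type*} [MetricSpace X]
    (q L α : ℝ) (hq : 0 ≤ q) (hL : 0 ≤ L) (hα : 0 ≤ α) (h : ℕ)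
    (g : ℕ → X → X) (r : ℕ → X → ℝ)
    (hg : ∀ (t : ℕ) (x y : X), dist (g t x) (g t y) ≤ q * dist x y)
    (hr : ∀ (t : ℕ) (x y : X), |r t x - r t y| ≤ L * dist x y)
    (u v xTil : ℕ → X)
    (h0 : u 0 = v 0)
    (hu : ∀ t : ℕ, u (t + 1) = g t (u t))
    (hmatch : ∀ t < h, dist (v t) (xTil t) ≤ α)
    (hv : ∀ t < h, v (t + 1) = g t (xTil t)) :
    |∑ t ∈ Finset.range h, r t (u t) - ∑ t ∈ Finset.range h, r t (xTil t)| ≤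
      (L * ∑ b ∈ Finset.range h, ∑ j ∈ Finset.range (h - b), q ^ j) * α := by
  have hreflect : ∑ b ∈ Finset.range h, ∑ j ∈ Finset.range (h - b), q ^ j =
      ∑ t ∈ Finset.range h, ∑ j ∈ Finset.range (t + 1), q ^ j := by
    rw [← Finset.sum_range_reflect]
    refine Finset.sum_congr rfl fun t ht => ?_
    have ht' := Finset.mem_range.mp ht
    rw [show h - (h - 1 - t) = t + 1 by omega]
  rw [hreflect, ← Finset.sum_sub_distrib, mul_assoc, Finset.sum_mul, Finset.mul_sum]
  refine (Finset.abs_sum_le_sum_abs _ _).trans (Finset.sum_le_sum fun t ht => ?_)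
  exact (hr t _ _).trans (mul_le_mul_of_nonneg_left
    (dist_le_geom_sum_mul hq hg h0 hu hmatch hv (Finset.mem_range.mp ht)) hL)
end
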